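/- arXiv:2603.11129 — 4 statements merged into one kernel-verified Lean document; each statement's English description precedes it below -/
import Mathlib

section
/- The second derivative of the Gamma function at 1 satisfies Γ''(1) = ∫_0^∞ e^{-x} (ln x)^2 dx = γ² + π²/6. -/
open Real MeasureTheory Finset

noncomputable def γ : ℝ := Real.eulerMascheroniConstant

lemma eF_loc : ContinuousOn (fun t : ℝ => ((Real.exp (-t) : ℝ) : ℂ)) (Set.Ioi 0) := by
  fun_prop

lemma eF_top (a : ℝ) : (fun t : ℝ => ((Real.exp (-t) : ℝ) : ℂ)) =O[Filter.atTop] (· ^ (-a)) := by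
  rw [← Asymptotics.isBigO_norm_left]
  simp_rw [Complex.norm_real, Asymptotics.isBigO_norm_left]
  simpa only [neg_one_mul] using (isLittleO_exp_neg_mul_rpow_atTop zero_lt_one (-a)).isBigO

lemma eF_bot : (fun t : ℝ => ((Real.exp (-t) : ℝ) : ℂ)) =O[nhdsWithin 0 (Set.Ioi 0)]
    (· ^ (-(0:ℝ))) := by
  simp_rw [neg_zero, Real.rpow_zero]
  refine Asymptotics.isBigO_const_of_tendsto
    (?_ : Filter.Tendsto _ _ (nhds (1 : ℂ))) one_ne_zero
  rw [(by simp : (1 : ℂ) = Real.exp (-0))]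
  exact (Complex.continuous_ofReal.comp
    (Real.continuous_exp.comp continuous_neg)).continuousWithinAt

/-- first derivative of complex Gamma as a Mellin transform -/
lemma gamma_d1 {s : ℂ} (hs : 0 < s.re) : HasDerivAt Complex.Gamma
    (mellin (fun t : ℝ => Real.log t • ((Real.exp (-t) : ℝ) : ℂ)) s) s := by
  have h := (mellin_hasDerivAt_of_isBigO_rpow (E := ℂ)
    (eF_loc.locallyIntegrableOn measurableSet_Ioi) (eF_top (s.re + 1)) (lt_add_one _)
    eF_bot hs).2
  rw [← Complex.GammaIntegral_eq_mellin] at h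
  refine h.congr_of_eventuallyEq ?_
  filter_upwards [(isOpen_lt continuous_const Complex.continuous_re).mem_nhds hs] with z hz
  exact Complex.Gamma_eq_integral hz

lemma mellin_d2 {s : ℂ} (hs : 0 < s.re) :
    HasDerivAt (mellin (fun t : ℝ => Real.log t • ((Real.exp (-t) : ℝ) : ℂ)))
    (mellin (fun t : ℝ => Real.log t • (Real.log t • ((Real.exp (-t) : ℝ) : ℂ))) s) s := by
  refine (mellin_hasDerivAt_of_isBigO_rpow (E := ℂ) (a := s.re + 1) (b := s.re / 2)
    (ContinuousOn.locallyIntegrableOn ?_ measurableSet_Ioi)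
    (isBigO_rpow_top_log_smul (lt_add_one _) (eF_top (s.re + 1 + 1))) (lt_add_one _)
    (isBigO_rpow_zero_log_smul (by linarith) eF_bot) (by linarith)).2
  have hlog : ContinuousOn Real.log (Set.Ioi 0) :=
    Real.continuousOn_log.mono (fun x hx => (ne_of_gt hx))
  exact hlog.smul eF_loc

lemma real_d2 : HasDerivAt (deriv Real.Gamma)
    (mellin (fun t : ℝ => Real.log t • (Real.log t • ((Real.exp (-t) : ℝ) : ℂ))) 1).re 1 := by
  have h := HasDerivAt.real_of_complex (z := 1) (mellin_d2 (s := ((1:ℝ):ℂ)) (by simp))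
  rw [Complex.ofReal_one] at h
  refine h.congr_of_eventuallyEq ?_
  filter_upwards [eventually_gt_nhds (zero_lt_one (α := ℝ))] with x hx
  exact (HasDerivAt.real_of_complex (z := x) (gamma_d1 (s := (x:ℂ)) (by simpa using hx))).deriv

lemma mellin_one_re :
    (mellin (fun t : ℝ => Real.log t • (Real.log t • ((Real.exp (-t) : ℝ) : ℂ))) 1).re =
    ∫ x in Set.Ioi (0:ℝ), Real.exp (-x) * (Real.log x) ^ 2 := by
  have : mellin (fun t : ℝ => Real.log t • (Real.log t • ((Real.exp (-t) : ℝ) : ℂ))) 1 =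
      ((∫ x in Set.Ioi (0:ℝ), Real.exp (-x) * (Real.log x) ^ 2 : ℝ) : ℂ) := by
    rw [mellin, ← integral_complex_ofReal]
    refine integral_congr_ae (Filter.Eventually.of_forall fun t => ?_)
    simp only [sub_self, Complex.cpow_zero, one_smul, Complex.real_smul]
    push_cast
    ring
  rw [this, Complex.ofReal_re]

lemma gamma_contDiffAt : ContDiffAt ℝ 3 Real.Gamma 1 := by
  have h : ContDiffAt ℂ 3 Complex.Gamma ((1:ℝ):ℂ) := by
    have hd : DifferentiableOn ℂ Complex.Gamma {z | 0 < z.re} := fun z hz =>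
      (gamma_d1 hz).differentiableAt.differentiableWithinAt
    exact (hd.analyticAt ((isOpen_lt continuous_const Complex.continuous_re).mem_nhds
      (by simp))).contDiffAt
  exact ContDiffAt.real_of_complex h

lemma refl_id : (fun x : ℝ => (Real.Gamma (1 + x) * Real.Gamma (1 - x)) * Real.sin (π * x))
    =ᶠ[nhds 0] fun x => π * x := by
  filter_upwards [Ioo_mem_nhds (show (-1:ℝ) < 0 by norm_num) zero_lt_one] with x hx
  rcases eq_or_ne x 0 with rfl | h0
  · simp
  have hs : Real.sin (π * x) ≠ 0 := by
    intro h
    rw [Real.sin_eq_zero_iff] at h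
    obtain ⟨n, hn⟩ := h
    have hnx : (n:ℝ) = x := by
      have := Real.pi_ne_zero
      apply mul_left_cancel₀ this
      linarith
    rw [← hnx] at hx h0
    have h1 : -1 < n := by exact_mod_cast hx.1
    have h2 : n < 1 := by exact_mod_cast hx.2
    have : n = 0 := by omega
    simp [this] at h0
  have := Real.Gamma_mul_Gamma_one_sub x
  rw [add_comm, Real.Gamma_add_one h0, mul_assoc x, this, mul_assoc, div_mul_cancel₀ _ hs, mul_comm]

lemma gamma_val : iteratedDeriv 2 Real.Gamma 1 =
    Real.eulerMascheroniConstant ^ 2 + Real.pi ^ 2 / 6 := by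
  have hA : ContDiffAt ℝ 3 (fun x : ℝ => Real.Gamma (1 + x)) 0 := by
    refine ContDiffAt.comp (g := Real.Gamma) 0 ?_ (by fun_prop)
    simpa using gamma_contDiffAt
  have hB : ContDiffAt ℝ 3 (fun x : ℝ => Real.Gamma (1 - x)) 0 := by
    refine ContDiffAt.comp (g := Real.Gamma) 0 ?_ (by fun_prop)
    simpa using gamma_contDiffAt
  have hS : ContDiffAt ℝ 3 (fun x : ℝ => Real.sin (π * x)) 0 := by fun_prop
  have hl := refl_id.iteratedDeriv_eq 3
  rw [iteratedDeriv_fun_mul (hA.mul hB) hS] at hl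
  have hs (n : ℕ) := congrFun (iteratedDeriv_comp_const_mul (n := n) Real.contDiff_sin π) 0
  have h2 := iteratedDeriv_fun_mul (n := 2) (hA.of_le (by norm_num)) (hB.of_le (by norm_num))
  have e2 : iteratedDeriv 2 Real.sin 0 = 0 := by
    simp [iteratedDeriv_succ]
  have e3 : iteratedDeriv 3 Real.sin 0 = -1 := by
    simp [iteratedDeriv_succ]
  have e4 : iteratedDeriv 3 (fun x : ℝ => π * x) 0 = 0 := by
    rw [iteratedDeriv_const_mul_field, iteratedDeriv_fun_id]; simp
  have e5 := Real.hasDerivAt_Gamma_one.deriv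
  simp only [Finset.sum_range_succ, Finset.sum_range_zero, hs, e4, iteratedDeriv_comp_const_add,
    iteratedDeriv_comp_const_sub] at hl h2
  simp [e2, e3, e5, h2, iteratedDeriv_one] at hl h2
  apply mul_left_cancel₀ (mul_ne_zero (by norm_num : (6:ℝ) ≠ 0) Real.pi_ne_zero)
  linear_combination hl

theorem stmt3 :
    iteratedDeriv 2 Real.Gamma 1 = ∫ x in Set.Ioi (0:ℝ), Real.exp (-x) * (Real.log x) ^ 2 ∧
    iteratedDeriv 2 Real.Gamma 1 = γ ^ 2 + Real.pi ^ 2 / 6 := by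
  refine ⟨?_, gamma_val⟩
  rw [iteratedDeriv_succ, iteratedDeriv_one, real_d2.deriv, mellin_one_re]
end

section
/- For every positive integer n, ∫_0^∞ n (ln x)^2 e^{-x} (1 - e^{-x})^{n-1} dx = γ² + π²/6 + 2γ·n·c_n + n·w_n, where c_n = -(1/n) ∑_{j=1}^n (-1)^j C(n, j) ln j and w_n = -(1/n) ∑_{j=1}^n (-1)^j C(n, j) (ln j)^2. -/
open Real MeasureTheory Finset

open Filter Asymptotics Topology in
theorem K_exists : ∃ K : ℕ → ℝ → ℂ, (∀ m t, K m t = (((Real.log t) ^ m * Real.exp (-t) : ℝ) : ℂ)) ∧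
    ∀ m, (ContinuousOn (K m) (Set.Ioi 0)) ∧ (∀ a : ℝ, K m =O[atTop] (fun t : ℝ => t ^ (-a))) ∧
      (∀ b : ℝ, 0 < b → K m =O[𝓝[>] 0] (fun t : ℝ => t ^ (-b))) := by
  refine ⟨fun m t => (((Real.log t) ^ m * Real.exp (-t) : ℝ) : ℂ), fun _ _ => rfl, ?_⟩
  intro m
  refine ⟨?_, ?_, ?_⟩
  · refine Complex.continuous_ofReal.comp_continuousOn ?_
    refine ContinuousOn.mul (ContinuousOn.pow ?_ _) (by fun_prop)
    exact Real.continuousOn_log.mono (fun x hx => ne_of_gt hx)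
  · induction m with
    | zero =>
      intro a
      have := (isLittleO_exp_neg_mul_rpow_atTop one_pos (-a)).isBigO
      rw [← isBigO_norm_left]
      rw [← isBigO_norm_left] at this
      refine this.congr_left ?_
      intro x
      rw [Complex.norm_real]
      simp
    | succ m ih =>
      intro a
      have := isBigO_rpow_top_log_smul (lt_add_one a) (ih (a+1))
      refine this.congr_left ?_
      intro x
      simp only [Complex.real_smul]
      push_cast
      ring
  · induction m with
    | zero =>
      intro b hb
      refine IsBigO.of_bound 1 ?_
      have h1 : ∀ᶠ t : ℝ in 𝓝[>] 0, t < 1 := nhdsWithin_le_nhds (Iio_mem_nhds one_pos)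
      filter_upwards [self_mem_nhdsWithin, h1] with t ht ht1
      have ht0 : (0:ℝ) < t := ht
      rw [Complex.norm_real]
      have h2 : Real.exp (-t) ≤ 1 := by simp [ht0.le]
      have h3 : 1 ≤ t ^ (-b) := Real.one_le_rpow_of_pos_of_le_one_of_nonpos ht0 ht1.le (by linarith)
      simp only [pow_zero, one_mul, Real.norm_eq_abs, abs_of_pos (Real.exp_pos _)]
      exact h2.trans (h3.trans (le_abs_self _))
    | succ m ih =>
      intro b hb
      have := isBigO_rpow_zero_log_smul (half_lt_self hb) (ih (b/2) (by linarith))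
      refine this.congr_left ?_
      intro x
      simp only [Complex.real_smul]
      push_cast
      ring

noncomputable def Mk (m : ℕ) (s : ℂ) : ℂ :=
  mellin (fun t : ℝ => (((Real.log t) ^ m * Real.exp (-t) : ℝ) : ℂ)) s

theorem Mk_deriv (m : ℕ) {s : ℂ} (hs : 0 < s.re) :
    MellinConvergent (fun t : ℝ => (((Real.log t) ^ m * Real.exp (-t) : ℝ) : ℂ)) s ∧
    HasDerivAt (Mk m) (Mk (m+1) s) s := by
  obtain ⟨K, hK, h⟩ := K_exists
  obtain ⟨h1, h2, h3⟩ := h m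
  have hKm : K m = (fun t : ℝ => (((Real.log t) ^ m * Real.exp (-t) : ℝ) : ℂ)) := funext (hK m)
  have hloc := h1.locallyIntegrableOn measurableSet_Ioi (μ := volume)
  have hc := mellinConvergent_of_isBigO_rpow hloc (h2 (s.re+1)) (lt_add_one _)
    (h3 (s.re/2) (by linarith)) (half_lt_self hs)
  have hd := (mellin_hasDerivAt_of_isBigO_rpow hloc (h2 (s.re+1)) (lt_add_one _)
    (h3 (s.re/2) (by linarith)) (half_lt_self hs)).2
  rw [hKm] at hc hd
  refine ⟨hc, ?_⟩
  refine hd.congr_deriv ?_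
  symm
  unfold Mk
  congr 1
  funext t
  simp only [Complex.real_smul]
  push_cast
  ring

theorem Mk_zero {s : ℂ} (hs : 0 < s.re) : Mk 0 s = Complex.Gamma s := by
  rw [Complex.Gamma_eq_integral hs, Complex.GammaIntegral, Mk, mellin]
  congr 1
  funext t
  simp [mul_comm]

theorem Mk_one_one : Mk 1 1 = -(Real.eulerMascheroniConstant : ℂ) := by
  have h := (Mk_deriv 0 (s := 1) (by simp)).2
  have h2 : HasDerivAt (Mk 0) (-(Real.eulerMascheroniConstant : ℂ)) 1 := by
    refine Complex.hasDerivAt_Gamma_one.congr_of_eventuallyEq ?_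
    have : {s : ℂ | 0 < s.re} ∈ nhds (1:ℂ) :=
      (isOpen_lt continuous_const Complex.continuous_re).mem_nhds (by simp)
    filter_upwards [this] with s hs using Mk_zero hs
  exact h.unique h2

noncomputable def Pk (m n : ℕ) (s : ℂ) : ℂ := Mk m (1 + s) * Mk n (1 - s)

theorem Pk_deriv (m n : ℕ) {s : ℂ} (h1 : -1 < s.re) (h2 : s.re < 1) :
    HasDerivAt (Pk m n) (Pk (m+1) n s - Pk m (n+1) s) s := by
  have a := (Mk_deriv m (s := 1 + s) (by simp; linarith)).2.comp s ((hasDerivAt_id s).const_add 1)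
  have b := (Mk_deriv n (s := 1 - s) (by simp; linarith)).2.comp s ((hasDerivAt_id s).const_sub 1)
  refine (a.mul b).congr_deriv ?_
  simp [Pk]
  ring

theorem refl_id_s8 {s : ℂ} (h1 : -1 < s.re) (h2 : s.re < 1) :
    Pk 0 0 s * Complex.sin (π * s) = π * s := by
  by_cases h0 : s = 0
  · simp [h0]
  have p1 : 0 < (1 + s).re := by simp; linarith
  have p2 : 0 < (1 - s).re := by simp; linarith
  have g := Complex.Gamma_mul_Gamma_one_sub s
  have n1 := Complex.Gamma_ne_zero_of_re_pos p1
  have n2 := Complex.Gamma_ne_zero_of_re_pos p2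
  rw [Pk, Mk_zero p1, Mk_zero p2]
  rw [add_comm, Complex.Gamma_add_one s h0] at n1 ⊢
  have hsin : Complex.sin (π * s) ≠ 0 := by
    intro h
    rw [h, div_zero] at g
    rcases mul_eq_zero.1 g with g | g
    · exact n1 (by rw [g, mul_zero])
    · exact n2 g
  rw [eq_div_iff hsin] at g
  linear_combination s * g

theorem Mk_two_one : Mk 2 1 = (Real.eulerMascheroniConstant : ℂ) ^ 2 + (π : ℂ) ^ 2 / 6 := by
  let U : Set ℂ := {s | -1 < s.re} ∩ {s | s.re < 1}
  have hU : IsOpen U := (isOpen_lt continuous_const Complex.continuous_re).inter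
    (isOpen_lt Complex.continuous_re continuous_const)
  have hS : ∀ s : ℂ, HasDerivAt (fun s : ℂ => Complex.sin (π * s)) (Complex.cos (π * s) * π) s := by
    intro s
    have := ((hasDerivAt_id s).const_mul (π:ℂ)).csin
    simpa using this
  have hC : ∀ s : ℂ, HasDerivAt (fun s : ℂ => Complex.cos (π * s)) (-Complex.sin (π * s) * π) s := by
    intro s
    have := ((hasDerivAt_id s).const_mul (π:ℂ)).ccos
    simpa using this
  have key : ∀ (f g f' g' : ℂ → ℂ), (∀ s ∈ U, f s = g s) → (∀ s ∈ U, HasDerivAt f (f' s) s) →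
      (∀ s ∈ U, HasDerivAt g (g' s) s) → ∀ s ∈ U, f' s = g' s := by
    intro f g f' g' h hf hg s hs
    refine (hf s hs).unique ((hg s hs).congr_of_eventuallyEq ?_)
    filter_upwards [hU.mem_nhds hs] with z hz using h z hz
  have P := fun m n s (hs : s ∈ U) => Pk_deriv m n (s := s) hs.1 hs.2
  have e0 := key _ _ _ _ (fun s (hs : s ∈ U) => refl_id_s8 hs.1 hs.2)
    (fun s hs => (P 0 0 s hs).mul (hS s)) (fun s hs => (hasDerivAt_id' s).const_mul (π:ℂ))
  have e1 := key _ _ _ _ e0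
    (fun s hs => (((P 1 0 s hs).sub (P 0 1 s hs)).mul (hS s)).add
      ((P 0 0 s hs).mul ((hC s).mul_const (π:ℂ)))) (fun s hs => hasDerivAt_const s _)
  have e2 := key _ _ _ _ e1
    (fun s hs => (((((P 2 0 s hs).sub (P 1 1 s hs)).sub ((P 1 1 s hs).sub (P 0 2 s hs))).mul (hS s)).add
      (((P 1 0 s hs).sub (P 0 1 s hs)).mul ((hC s).mul_const (π:ℂ)))).add
      ((((P 1 0 s hs).sub (P 0 1 s hs)).mul ((hC s).mul_const (π:ℂ))).add
      ((P 0 0 s hs).mul (((hS s).neg.mul_const (π:ℂ)).mul_const (π:ℂ)))))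
    (fun s hs => hasDerivAt_const s _) 0 (by simp [U])
  have hpi : (π:ℂ) ≠ 0 := Complex.ofReal_ne_zero.2 Real.pi_ne_zero
  have m0 : Mk 0 1 = 1 := by rw [Mk_zero (by simp), Complex.Gamma_one]
  simp [Pk, m0, Mk_one_one] at e2
  have : (6 * (π:ℂ)) * Mk 2 1 = (6 * (π:ℂ)) * ((Real.eulerMascheroniConstant : ℂ) ^ 2 + (π : ℂ) ^ 2 / 6) := by
    linear_combination e2
  exact mul_left_cancel₀ (by simp [hpi]) this

theorem int_log_pow (m : ℕ) :
    IntegrableOn (fun t : ℝ => (Real.log t) ^ m * Real.exp (-t)) (Set.Ioi 0) := by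
  have := (Mk_deriv m (s := 1) (by simp)).1
  unfold MellinConvergent at this
  simp only [sub_self, Complex.cpow_zero, one_smul] at this
  exact this.re

theorem Mk_at_one (m : ℕ) :
    Mk m 1 = ((∫ t in Set.Ioi (0:ℝ), (Real.log t) ^ m * Real.exp (-t) : ℝ) : ℂ) := by
  unfold Mk mellin
  simp only [sub_self, Complex.cpow_zero, one_smul]
  exact integral_ofReal

theorem I_zero : ∫ t in Set.Ioi (0:ℝ), (Real.log t) ^ 0 * Real.exp (-t) = 1 := by
  have m0 : Mk 0 1 = 1 := by rw [Mk_zero (by simp), Complex.Gamma_one]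
  rw [Mk_at_one] at m0
  exact_mod_cast m0

theorem I_one : ∫ t in Set.Ioi (0:ℝ), (Real.log t) ^ 1 * Real.exp (-t) = -γ := by
  have m0 := Mk_one_one
  rw [Mk_at_one] at m0
  exact_mod_cast m0

theorem I_two : ∫ t in Set.Ioi (0:ℝ), (Real.log t) ^ 2 * Real.exp (-t) = γ ^ 2 + π ^ 2 / 6 := by
  have m0 := Mk_two_one
  rw [Mk_at_one] at m0
  exact_mod_cast m0

theorem J_int (j : ℕ) (hj : 1 ≤ j) :
    IntegrableOn (fun x : ℝ => (Real.log x) ^ 2 * Real.exp (-(j * x))) (Set.Ioi 0) ∧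
    ∫ x in Set.Ioi (0:ℝ), (Real.log x) ^ 2 * Real.exp (-(j * x)) =
      (j:ℝ)⁻¹ * (γ ^ 2 + π ^ 2 / 6 + 2 * γ * Real.log j + Real.log j ^ 2) := by
  have hj0 : (0:ℝ) < j := by exact_mod_cast hj
  let g : ℝ → ℝ := fun x => (Real.log x - Real.log j) ^ 2 * Real.exp (-x)
  have hg : ∀ x, g x = (Real.log x) ^ 2 * Real.exp (-x)
      + (-(2 * Real.log j)) * ((Real.log x) ^ 1 * Real.exp (-x))
      + Real.log j ^ 2 * ((Real.log x) ^ 0 * Real.exp (-x)) := by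
    intro x; simp only [g]; ring
  have i2 := int_log_pow 2
  have i1 := (int_log_pow 1).const_mul (-(2 * Real.log j))
  have i0 := (int_log_pow 0).const_mul (Real.log j ^ 2)
  have heq : Set.EqOn (fun x : ℝ => g (j * x))
      (fun x : ℝ => (Real.log x) ^ 2 * Real.exp (-(j * x))) (Set.Ioi 0) := by
    intro x hx
    simp only [g]
    rw [Real.log_mul hj0.ne' (ne_of_gt hx)]
    ring
  have gi : IntegrableOn g (Set.Ioi 0) := by
    rw [funext hg]
    exact (i2.add i1).add i0
  constructor
  · refine IntegrableOn.congr_fun ?_ heq measurableSet_Ioi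
    rw [integrableOn_Ioi_comp_mul_left_iff g 0 hj0, mul_zero]
    exact gi
  · rw [← setIntegral_congr_fun measurableSet_Ioi heq, integral_comp_mul_left_Ioi g 0 hj0, mul_zero,
      funext hg]
    have a1 := integral_add (i2.add i1) i0
    have a2 := integral_add i2 i1
    simp only [Pi.add_apply] at a1
    rw [a1, a2, integral_const_mul,
      integral_const_mul, I_zero, I_one, I_two, smul_eq_mul]
    ring

theorem stmt8 (n : ℕ) (hn : 1 ≤ n)
    (c w : ℝ)
    (hc : c = -(1 / (n : ℝ)) * ∑ j ∈ Finset.Icc 1 n, (-1 : ℝ) ^ j * (n.choose j : ℝ) * Real.log j)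
    (hw : w = -(1 / (n : ℝ)) * ∑ j ∈ Finset.Icc 1 n, (-1 : ℝ) ^ j * (n.choose j : ℝ) * (Real.log j) ^ 2) :
    ∫ x in Set.Ioi (0:ℝ), (n : ℝ) * (Real.log x) ^ 2 * Real.exp (-x) * (1 - Real.exp (-x)) ^ (n - 1)
      = γ ^ 2 + Real.pi ^ 2 / 6 + 2 * γ * n * c + n * w := by
  obtain ⟨N, rfl⟩ : ∃ N, n = N + 1 := ⟨n - 1, by omega⟩
  have hn0 : ((N + 1 : ℕ) : ℝ) ≠ 0 := by positivity
  have reidx : ∀ f : ℕ → ℝ, ∑ j ∈ Finset.Icc 1 (N+1), f j = ∑ k ∈ Finset.range (N+1), f (k+1) := by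
    intro f
    rw [Finset.range_eq_Ico, Finset.sum_Ico_add' f 0 (N+1) 1]
    rfl
  have hch : ∀ k : ℕ, ((N+1 : ℕ) : ℝ) * (N.choose k : ℝ) = ((N+1).choose (k+1) : ℝ) * ((k+1 : ℕ) : ℝ) := by
    intro k
    exact_mod_cast Nat.add_one_mul_choose_eq N k
  have hexp : ∀ x : ℝ, ((N+1 : ℕ) : ℝ) * (Real.log x) ^ 2 * Real.exp (-x) * (1 - Real.exp (-x)) ^ (N + 1 - 1)
      = ∑ k ∈ Finset.range (N+1), (-((-1:ℝ) ^ (k+1) * ((N+1).choose (k+1) : ℝ) * ((k+1 : ℕ) : ℝ))) *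
        ((Real.log x) ^ 2 * Real.exp (-(((k+1 : ℕ) : ℝ) * x))) := by
    intro x
    rw [Nat.add_sub_cancel, sub_eq_neg_add, add_pow, Finset.mul_sum]
    refine Finset.sum_congr rfl fun k _ => ?_
    have : Real.exp (-(((k+1 : ℕ) : ℝ) * x)) = Real.exp (-x) ^ (k+1) := by
      rw [← Real.exp_nat_mul]; congr 1; ring
    rw [this, neg_pow (Real.exp (-x)), one_pow]
    linear_combination (Real.log x) ^ 2 * Real.exp (-x) ^ (k+1) * (-1) ^ k * hch k
  have halt : ∑ k ∈ Finset.range (N+1), (-1:ℝ) ^ (k+1) * ((N+1).choose (k+1) : ℝ) = -1 := by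
    have h := Int.alternating_sum_range_choose_of_ne (n := N+1) (by omega)
    rw [Finset.sum_range_succ'] at h
    have h' : ((∑ k ∈ Finset.range (N+1), (-1:ℤ) ^ (k+1) * ((N+1).choose (k+1) : ℤ) : ℤ) : ℝ) = -1 := by
      have : ∑ k ∈ Finset.range (N+1), (-1:ℤ) ^ (k+1) * ((N+1).choose (k+1) : ℤ) = -1 := by
        simp at h ⊢; linarith
      rw [this]; simp
    push_cast at h'
    exact h'
  rw [reidx] at hc hw
  have hc' : ((N+1 : ℕ) : ℝ) * c = -∑ k ∈ Finset.range (N+1), (-1 : ℝ) ^ (k+1) * ((N+1).choose (k+1) : ℝ) * Real.log ((k+1 : ℕ) : ℝ) := by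
    rw [hc]; field_simp
  have hw' : ((N+1 : ℕ) : ℝ) * w = -∑ k ∈ Finset.range (N+1), (-1 : ℝ) ^ (k+1) * ((N+1).choose (k+1) : ℝ) * Real.log ((k+1 : ℕ) : ℝ) ^ 2 := by
    rw [hw]; field_simp
  simp_rw [hexp]
  rw [integral_finsetSum _ (fun k _ => (J_int (k+1) (by omega)).1.const_mul _)]
  simp_rw [integral_const_mul]
  have hterm : ∀ k ∈ Finset.range (N+1), (-((-1:ℝ) ^ (k+1) * ((N+1).choose (k+1) : ℝ) * ((k+1 : ℕ) : ℝ))) *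
        (∫ x in Set.Ioi (0:ℝ), (Real.log x) ^ 2 * Real.exp (-(((k+1 : ℕ) : ℝ) * x)))
      = -(γ ^ 2 + π ^ 2 / 6) * ((-1:ℝ) ^ (k+1) * ((N+1).choose (k+1) : ℝ))
        + (-(2 * γ)) * ((-1 : ℝ) ^ (k+1) * ((N+1).choose (k+1) : ℝ) * Real.log ((k+1 : ℕ) : ℝ))
        + (-1) * ((-1 : ℝ) ^ (k+1) * ((N+1).choose (k+1) : ℝ) * Real.log ((k+1 : ℕ) : ℝ) ^ 2) := by
    intro k _
    rw [(J_int (k+1) (by omega)).2]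
    have : ((k+1 : ℕ) : ℝ) ≠ 0 := by positivity
    field_simp
    ring
  rw [Finset.sum_congr rfl hterm, Finset.sum_add_distrib, Finset.sum_add_distrib, ← Finset.mul_sum,
    ← Finset.mul_sum, ← Finset.mul_sum, halt]
  linear_combination (-(2 * γ)) * hc' - hw'
end

section
/- For every positive integer n, π²/6 > n² c_n² − n w_n, where c_n = -(1/n) ∑_{j=1}^n (-1)^j C(n, j) ln j and w_n = -(1/n) ∑_{j=1}^n (-1)^j C(n, j) (ln j)^2. -/
open Real MeasureTheory Finset

/-- `(log t)^k e^{-t}`, defined recursively. -/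
noncomputable def lexp : ℕ → ℝ → ℂ
  | 0 => fun t => ((Real.exp (-t) : ℝ) : ℂ)
  | (k+1) => fun t => Real.log t • lexp k t

lemma lexp_eq (k : ℕ) (t : ℝ) : lexp k t = ((Real.log t ^ k * Real.exp (-t) : ℝ) : ℂ) := by
  induction k with
  | zero => simp [lexp]
  | succ k ih => simp only [lexp, ih]; push_cast; simp; ring

lemma lexp_top (k : ℕ) : ∀ a : ℝ, lexp k =O[Filter.atTop] (fun t : ℝ => t ^ (-a)) := by
  induction k with
  | zero =>
    intro a
    rw [← Asymptotics.isBigO_norm_left]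
    simp_rw [lexp, Complex.norm_real, Asymptotics.isBigO_norm_left]
    simpa only [neg_one_mul] using (isLittleO_exp_neg_mul_rpow_atTop zero_lt_one _).isBigO
  | succ k ih =>
    intro a
    exact isBigO_rpow_top_log_smul (lt_add_one a) (ih (a+1))

lemma lexp_bot (k : ℕ) : ∀ b : ℝ, 0 < b →
    lexp k =O[nhdsWithin 0 (Set.Ioi 0)] (fun t : ℝ => t ^ (-b)) := by
  have h0 : lexp 0 =O[nhdsWithin 0 (Set.Ioi 0)] (fun t : ℝ => t ^ (-(0:ℝ))) := by
    simp_rw [neg_zero, Real.rpow_zero]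
    refine Asymptotics.isBigO_const_of_tendsto (?_ : Filter.Tendsto _ _ (nhds (1 : ℂ))) one_ne_zero
    rw [(by simp : (1 : ℂ) = Real.exp (-0))]
    exact (Complex.continuous_ofReal.comp
      (Real.continuous_exp.comp continuous_neg)).continuousWithinAt
  induction k with
  | zero =>
    intro b hb
    refine h0.trans ?_
    apply Asymptotics.IsBigO.of_bound 1
    have : Set.Ioo (0:ℝ) 1 ∈ nhdsWithin (0:ℝ) (Set.Ioi 0) := Ioo_mem_nhdsGT one_pos
    filter_upwards [this] with t ht
    rw [Real.norm_of_nonneg (by have := ht.1; positivity),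
      Real.norm_of_nonneg (by have := ht.1; positivity), one_mul]
    exact Real.rpow_le_rpow_of_exponent_ge ht.1 ht.2.le (by linarith)
  | succ k ih =>
    intro b hb
    exact isBigO_rpow_zero_log_smul (half_lt_self hb) (ih (b/2) (by linarith))

lemma lexp_loc (k : ℕ) : LocallyIntegrableOn (lexp k) (Set.Ioi 0) := by
  refine ContinuousOn.locallyIntegrableOn ?_ measurableSet_Ioi
  have : lexp k = fun t => ((Real.log t ^ k * Real.exp (-t) : ℝ) : ℂ) := funext (lexp_eq k)
  rw [this]
  intro t ht
  have ht' : t ≠ 0 := ne_of_gt ht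
  apply ContinuousAt.continuousWithinAt
  fun_prop (disch := assumption)

lemma mellin_deriv (k : ℕ) (s : ℂ) (hs : 0 < s.re) :
    HasDerivAt (mellin (lexp k)) (mellin (lexp (k+1)) s) s :=
  (mellin_hasDerivAt_of_isBigO_rpow (lexp_loc k) (lexp_top k (s.re+1)) (lt_add_one _)
    (lexp_bot k (s.re/2) (by linarith)) (by linarith)).2

lemma mellin_conv (k : ℕ) (s : ℂ) (hs : 0 < s.re) : MellinConvergent (lexp k) s :=
  mellinConvergent_of_isBigO_rpow (lexp_loc k) (lexp_top k (s.re+1)) (lt_add_one _)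
    (lexp_bot k (s.re/2) (by linarith)) (by linarith)

lemma mellin_zero (s : ℂ) (hs : 0 < s.re) : mellin (lexp 0) s = Complex.Gamma s := by
  rw [Complex.Gamma_eq_integral hs, Complex.GammaIntegral_eq_mellin]; rfl

lemma log_int (k : ℕ) : IntegrableOn (fun t : ℝ => Real.log t ^ k * Real.exp (-t)) (Set.Ioi 0) := by
  have h := mellin_conv k 1 (by simp)
  simp only [MellinConvergent, sub_self, Complex.cpow_zero, one_smul, lexp_eq] at h
  have := h.re
  simpa only [IntegrableOn, RCLike.re_to_complex, Complex.ofReal_re] using this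

lemma mellin_one (k : ℕ) : mellin (lexp k) 1 =
    ((∫ t in Set.Ioi (0:ℝ), Real.log t ^ k * Real.exp (-t) : ℝ) : ℂ) := by
  simp only [mellin, sub_self, Complex.cpow_zero, one_smul, lexp_eq]
  exact integral_ofReal

lemma deriv_zero_on {U : Set ℂ} (hU : IsOpen U) {P P' : ℂ → ℂ} (h : ∀ s ∈ U, P s = 0)
    (hd : ∀ s ∈ U, HasDerivAt P (P' s) s) : ∀ s ∈ U, P' s = 0 := by
  intro s hs
  have h1 : P =ᶠ[nhds s] fun _ => 0 := by
    filter_upwards [hU.mem_nhds hs] with z hz using h z hz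
  exact (hd s hs).unique ((hasDerivAt_const s (0:ℂ)).congr_of_eventuallyEq h1)

lemma second : mellin (lexp 2) 1 = mellin (lexp 1) 1 ^ 2 + (π:ℂ)^2 / 6 := by
  set M := fun k => mellin (lexp k) with hM
  let U : Set ℂ := {s | -1 < s.re ∧ s.re < 1}
  have hU : IsOpen U := (isOpen_lt continuous_const Complex.continuous_re).inter
    (isOpen_lt Complex.continuous_re continuous_const)
  have hp : ∀ k, ∀ s ∈ U, HasDerivAt (fun s => M k (1+s)) (M (k+1) (1+s)) s := by
    intro k s hs
    exact (mellin_deriv k (1+s) (by simp; linarith [hs.1])).comp_const_add 1 s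
  have hm : ∀ k, ∀ s ∈ U, HasDerivAt (fun s => M k (1-s)) (-M (k+1) (1-s)) s := by
    intro k s hs
    exact (mellin_deriv k (1-s) (by simp; linarith [hs.2])).comp_const_sub 1 s
  have hsin : ∀ s, HasDerivAt (fun s : ℂ => Complex.sin (π * s)) (Complex.cos (π*s) * (π * 1)) s :=
    fun s => ((hasDerivAt_id s).const_mul (π:ℂ)).csin
  have hcos : ∀ s, HasDerivAt (fun s : ℂ => Complex.cos (π * s)) (-Complex.sin (π*s) * (π * 1)) s :=
    fun s => ((hasDerivAt_id s).const_mul (π:ℂ)).ccos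
  let K0 := fun s => M 0 (1+s) * M 0 (1-s)
  let K1 := fun s => M 1 (1+s) * M 0 (1-s) - M 0 (1+s) * M 1 (1-s)
  let K2 := fun s => M 2 (1+s) * M 0 (1-s) - 2 * (M 1 (1+s) * M 1 (1-s)) + M 0 (1+s) * M 2 (1-s)
  let K3 := fun s => M 3 (1+s) * M 0 (1-s) - 3 * (M 2 (1+s) * M 1 (1-s))
    + 3 * (M 1 (1+s) * M 2 (1-s)) - M 0 (1+s) * M 3 (1-s)
  have d0 : ∀ s ∈ U, HasDerivAt K0 (K1 s) s := fun s hs =>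
    ((hp 0 s hs).mul (hm 0 s hs)).congr_deriv (by simp only [K1]; ring)
  have d1 : ∀ s ∈ U, HasDerivAt K1 (K2 s) s := fun s hs =>
    (((hp 1 s hs).mul (hm 0 s hs)).sub ((hp 0 s hs).mul (hm 1 s hs))).congr_deriv
      (by simp only [K2]; ring)
  have d2 : ∀ s ∈ U, HasDerivAt K2 (K3 s) s := fun s hs =>
    ((((hp 2 s hs).mul (hm 0 s hs)).sub (((hp 1 s hs).mul (hm 1 s hs)).const_mul 2)).add
      ((hp 0 s hs).mul (hm 2 s hs))).congr_deriv (by simp only [K3]; ring)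
  have e0 : ∀ s ∈ U, K0 s * Complex.sin (π * s) - π * s = 0 := by
    intro s hs
    by_cases h0 : s = 0
    · simp [h0]
    simp only [K0, hM]
    rw [mellin_zero _ (by simp; linarith [hs.1]), mellin_zero _ (by simp; linarith [hs.2]),
      add_comm, Complex.Gamma_add_one s h0, mul_assoc s, Complex.Gamma_mul_Gamma_one_sub]
    have : Complex.sin (π * s) ≠ 0 := by
      rw [Complex.sin_ne_zero_iff]
      intro k hk
      have hpi : (π:ℂ) ≠ 0 := by exact_mod_cast Real.pi_ne_zero
      have hk' : s = (k:ℂ) := by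
        apply mul_left_cancel₀ hpi; rw [hk]; ring
      have h1 := hs.1
      have h2 := hs.2
      rw [hk', Complex.intCast_re] at h1 h2
      have h1' : -1 < k := by exact_mod_cast h1
      have h2' : k < 1 := by exact_mod_cast h2
      have : k = 0 := by omega
      apply h0; rw [hk', this]; simp
    rw [mul_assoc, div_mul_cancel₀ _ this]
    ring
  have e1 := deriv_zero_on hU (P' := fun s => K1 s * Complex.sin (π * s)
      + π * (K0 s * Complex.cos (π * s)) - π) e0 (fun s hs =>
    (((d0 s hs).mul (hsin s)).sub ((hasDerivAt_id s).const_mul (π:ℂ))).congr_deriv (by ring))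
  have e2 := deriv_zero_on hU (P' := fun s => K2 s * Complex.sin (π * s)
      + 2 * π * (K1 s * Complex.cos (π * s)) - π ^ 2 * (K0 s * Complex.sin (π * s))) e1 (fun s hs =>
    ((((d1 s hs).mul (hsin s)).add (((d0 s hs).mul (hcos s)).const_mul (π:ℂ))).sub_const
      (π:ℂ)).congr_deriv (by ring))
  have e3 := deriv_zero_on hU (P' := fun s => K3 s * Complex.sin (π * s)
      + 3 * π * (K2 s * Complex.cos (π * s)) - 3 * π ^ 2 * (K1 s * Complex.sin (π * s))
      - π ^ 3 * (K0 s * Complex.cos (π * s))) e2 (fun s hs =>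
    ((((d2 s hs).mul (hsin s)).add (((d1 s hs).mul (hcos s)).const_mul (2 * π:ℂ))).sub
      (((d0 s hs).mul (hsin s)).const_mul ((π:ℂ)^2))).congr_deriv (by ring))
  have h := e3 0 (by simp [U])
  have hM0 : M 0 1 = 1 := by simp only [hM]; rw [mellin_zero _ (by simp), Complex.Gamma_one]
  simp only [K3, K2, K1, K0, mul_zero, Complex.sin_zero, Complex.cos_zero, add_zero, sub_zero,
    hM0, mul_one, one_mul, zero_add] at h
  have hpi : (π:ℂ) ≠ 0 := by exact_mod_cast Real.pi_ne_zero
  have h' : (π:ℂ) * (6 * (M 2 1 - M 1 1 ^ 2 - π^2/6)) = 0 := by linear_combination h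
  have h'' := (mul_eq_zero.mp h').resolve_left hpi
  change M 2 1 = M 1 1 ^ 2 + _
  linear_combination h'' / 6

lemma second_real : ∫ t in Set.Ioi (0:ℝ), Real.log t ^ 2 * Real.exp (-t) =
    (∫ t in Set.Ioi (0:ℝ), Real.log t ^ 1 * Real.exp (-t)) ^ 2 + π ^ 2 / 6 := by
  have h := second
  rw [mellin_one, mellin_one] at h
  exact_mod_cast h

lemma zeroth : ∫ t in Set.Ioi (0:ℝ), Real.log t ^ 0 * Real.exp (-t) = 1 := by
  have h := mellin_one 0
  rw [mellin_zero _ (by simp), Complex.Gamma_one] at h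
  exact_mod_cast h.symm

lemma shifted_int (b : ℝ) :
    IntegrableOn (fun t : ℝ => Real.exp (-t) * (Real.log t - b) ^ 2) (Set.Ioi 0) := by
  have h := ((log_int 2).sub ((log_int 1).const_mul (2*b))).add ((log_int 0).const_mul (b^2))
  refine h.congr (Filter.Eventually.of_forall fun t => ?_)
  simp only [Pi.add_apply, Pi.sub_apply]; ring

lemma shifted (b : ℝ) :
    ∫ t in Set.Ioi (0:ℝ), Real.exp (-t) * (Real.log t - b) ^ 2 =
    π ^ 2 / 6 + ((∫ t in Set.Ioi (0:ℝ), Real.log t ^ 1 * Real.exp (-t)) - b) ^ 2 := by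
  have e : ∀ t : ℝ, Real.exp (-t) * (Real.log t - b) ^ 2 = Real.log t ^ 2 * Real.exp (-t)
      - (2*b) * (Real.log t ^ 1 * Real.exp (-t)) + b^2 * (Real.log t ^ 0 * Real.exp (-t)) := by
    intro t; ring
  simp_rw [e]
  have hi : IntegrableOn (fun t : ℝ => Real.log t ^ 2 * Real.exp (-t)
      - (2*b) * (Real.log t ^ 1 * Real.exp (-t))) (Set.Ioi 0) :=
    (log_int 2).sub ((log_int 1).const_mul (2*b))
  rw [integral_add hi ((log_int 0).const_mul (b^2)),
    integral_sub (log_int 2) ((log_int 1).const_mul (2*b)), integral_const_mul, integral_const_mul,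
    second_real, zeroth]
  ring

lemma scaled_aux (j m : ℝ) (hj : 0 < j) (t : ℝ) (ht : t ∈ Set.Ioi (0:ℝ)) :
    Real.exp (-(j*t)) * (Real.log (j*t) - (Real.log j + m)) ^ 2
      = Real.exp (-(j*t)) * (Real.log t - m)^2 := by
  rw [Real.log_mul hj.ne' (ne_of_gt ht)]; ring

lemma scaled_int (j m : ℝ) (hj : 0 < j) :
    IntegrableOn (fun t : ℝ => Real.exp (-(j*t)) * (Real.log t - m) ^ 2) (Set.Ioi 0) := by
  have h := (integrableOn_Ioi_comp_mul_left_iff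
    (fun t : ℝ => Real.exp (-t) * (Real.log t - (Real.log j + m)) ^ 2) 0 hj).2
    (by rw [mul_zero]; exact shifted_int _)
  exact h.congr_fun (fun t ht => scaled_aux j m hj t ht) measurableSet_Ioi

lemma scaled (j m : ℝ) (hj : 0 < j) :
    j * ∫ t in Set.Ioi (0:ℝ), Real.exp (-(j*t)) * (Real.log t - m) ^ 2 =
    π ^ 2 / 6 + ((∫ t in Set.Ioi (0:ℝ), Real.log t ^ 1 * Real.exp (-t)) - (Real.log j + m)) ^ 2 := by
  have h := integral_comp_mul_left_Ioi'
    (fun t : ℝ => Real.exp (-t) * (Real.log t - (Real.log j + m)) ^ 2) 0 hj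
  rw [mul_zero, shifted, smul_eq_mul,
    setIntegral_congr_fun measurableSet_Ioi (fun t ht => scaled_aux j m hj t ht)] at h
  exact h

lemma choose_sum (n : ℕ) (x : ℝ) :
    ∑ j ∈ Finset.Icc 1 (n+1), (-1 : ℝ) ^ j * ((n+1).choose j : ℝ) * (j * x ^ j)
      = -((n+1) * x * (1 - x) ^ n) := by
  have e : Finset.Icc 1 (n+1) = (Finset.range (n+1)).image (· + 1) := by
    ext a; simp only [Finset.mem_Icc, Finset.mem_image, Finset.mem_range]
    constructor
    · intro h; exact ⟨a-1, by omega, by omega⟩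
    · rintro ⟨b, hb, rfl⟩; omega
  rw [e, Finset.sum_image (by intro a _ b _ h; simpa using h),
    show (1 - x) = -x + 1 by ring, add_pow, Finset.mul_sum, ← Finset.sum_neg_distrib]
  refine Finset.sum_congr rfl fun k _ => ?_
  have h : ((n:ℝ)+1) * n.choose k = (n+1).choose (k+1) * (k+1) := by
    exact_mod_cast Nat.add_one_mul_choose_eq n k
  rw [one_pow, neg_pow x k]
  push_cast
  linear_combination x * ((-1)^k * x^k) * h

lemma choose_sum_one (n : ℕ) :
    ∑ j ∈ Finset.Icc 1 (n+1), (-1 : ℝ) ^ j * ((n+1).choose j : ℝ) = -1 := by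
  have h := Int.alternating_sum_range_choose (n := n+1)
  have e : Finset.range (n+1+1) = insert 0 (Finset.Icc 1 (n+1)) := by
    ext a; simp only [Finset.mem_insert, Finset.mem_Icc, Finset.mem_range]; omega
  rw [e, Finset.sum_insert (by simp)] at h
  simp at h
  have h2 : ∑ j ∈ Finset.Icc 1 (n+1), (-1 : ℤ) ^ j * ((n+1).choose j : ℤ) = -1 := by linarith
  exact_mod_cast h2

theorem stmt9 (n : ℕ) (hn : 1 ≤ n)
    (c w : ℝ)
    (hc : c = -(1 / (n : ℝ)) * ∑ j ∈ Finset.Icc 1 n, (-1 : ℝ) ^ j * (n.choose j : ℝ) * Real.log j)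
    (hw : w = -(1 / (n : ℝ)) * ∑ j ∈ Finset.Icc 1 n, (-1 : ℝ) ^ j * (n.choose j : ℝ) * (Real.log j) ^ 2) :
    Real.pi ^ 2 / 6 > (n : ℝ) ^ 2 * c ^ 2 - (n : ℝ) * w := by
  obtain ⟨n, rfl⟩ : ∃ k, n = k + 1 := ⟨n - 1, by omega⟩
  set N := n + 1 with hN
  set A := ∑ j ∈ Finset.Icc 1 N, (-1 : ℝ) ^ j * (N.choose j : ℝ) * Real.log j with hA
  set B := ∑ j ∈ Finset.Icc 1 N, (-1 : ℝ) ^ j * (N.choose j : ℝ) * (Real.log j) ^ 2 with hB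
  have hN0 : (N:ℝ) ≠ 0 := by positivity
  have h1 : (N : ℝ) ^ 2 * c ^ 2 - (N : ℝ) * w = A ^ 2 + B := by
    rw [hc, hw]; field_simp; ring
  rw [h1]
  set L := ∫ t in Set.Ioi (0:ℝ), Real.log t ^ 1 * Real.exp (-t) with hL
  let m := L + A
  have hfin : ∀ t : ℝ, (∑ j ∈ Finset.Icc 1 N, (-1 : ℝ) ^ j * (N.choose j : ℝ) *
      (j * (Real.exp (-(j*t)) * (Real.log t - m) ^ 2)))
      = -((N * Real.exp (-t) * (1 - Real.exp (-t)) ^ n) * (Real.log t - m) ^ 2) := by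
    intro t
    have := choose_sum n (Real.exp (-t))
    rw [hN]; push_cast
    rw [← neg_mul, ← this, Finset.sum_mul]
    refine Finset.sum_congr rfl fun j _ => ?_
    rw [← Real.exp_nat_mul]
    ring_nf
  have hint : ∀ j ∈ Finset.Icc 1 N, IntegrableOn (fun t => (-1 : ℝ) ^ j * (N.choose j : ℝ) *
      (j * (Real.exp (-(j*t)) * (Real.log t - m) ^ 2))) (Set.Ioi 0) := by
    intro j hj
    have hj' : (0:ℝ) < j := by exact_mod_cast (Finset.mem_Icc.1 hj).1
    exact ((scaled_int j m hj').const_mul _).const_mul _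
  have hS := integral_finsetSum (μ := volume.restrict (Set.Ioi 0)) (Finset.Icc 1 N) hint
  have hR : ∑ j ∈ Finset.Icc 1 N, ∫ t in Set.Ioi (0:ℝ), (-1 : ℝ) ^ j * (N.choose j : ℝ) *
      (j * (Real.exp (-(j*t)) * (Real.log t - m) ^ 2)) = -(π^2/6 - A^2 - B) := by
    have : ∀ j ∈ Finset.Icc 1 N, (∫ t in Set.Ioi (0:ℝ), (-1 : ℝ) ^ j * (N.choose j : ℝ) *
      (j * (Real.exp (-(j*t)) * (Real.log t - m) ^ 2))) =
        (π^2/6 + A^2) * ((-1 : ℝ) ^ j * (N.choose j : ℝ))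
        + 2 * A * ((-1 : ℝ) ^ j * (N.choose j : ℝ) * Real.log j)
        + (-1 : ℝ) ^ j * (N.choose j : ℝ) * Real.log j ^ 2 := by
      intro j hj
      have hj' : (0:ℝ) < j := by exact_mod_cast (Finset.mem_Icc.1 hj).1
      rw [integral_const_mul, integral_const_mul, scaled j m hj', ← hL]
      simp only [m]
      ring
    rw [Finset.sum_congr rfl this, Finset.sum_add_distrib, Finset.sum_add_distrib,
      ← Finset.mul_sum, ← Finset.mul_sum, ← hA, ← hB, choose_sum_one]
    ring
  rw [hR] at hS
  simp_rw [hfin] at hS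
  rw [integral_neg, neg_inj] at hS
  have hI : IntegrableOn (fun t => (N * Real.exp (-t) * (1 - Real.exp (-t)) ^ n) *
      (Real.log t - m) ^ 2) (Set.Ioi 0) := by
    have := (integrable_finsetSum (μ := volume.restrict (Set.Ioi 0)) (Finset.Icc 1 N) hint).neg
    refine this.congr (Filter.Eventually.of_forall fun t => ?_)
    simp only [Pi.neg_apply, hfin, neg_neg]
  have hpos : 0 < ∫ t in Set.Ioi (0:ℝ), (N * Real.exp (-t) * (1 - Real.exp (-t)) ^ n) *
      (Real.log t - m) ^ 2 := by
    rw [setIntegral_pos_iff_support_of_nonneg_ae _ hI]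
    · refine lt_of_lt_of_le ?_ (measure_mono (s := Set.Ioi (Real.exp m)) ?_)
      · simp
      · intro t ht
        have ht0 : 0 < t := (Real.exp_pos m).trans ht
        refine ⟨?_, ht0⟩
        have h2 : m < Real.log t := (Real.lt_log_iff_exp_lt ht0).2 ht
        have h3 : Real.exp (-t) < 1 := (Real.exp_lt_one_iff).2 (by linarith)
        have h4 : 0 < 1 - Real.exp (-t) := by linarith
        have h5 : 0 < Real.log t - m := by linarith
        rw [Function.mem_support]
        positivity
    · rw [Filter.EventuallyLE, ae_restrict_iff' measurableSet_Ioi]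
      refine Filter.Eventually.of_forall fun t ht => ?_
      have h3 : Real.exp (-t) < 1 := (Real.exp_lt_one_iff).2 (by simpa using ht)
      have h4 : 0 < 1 - Real.exp (-t) := by linarith
      simp only [Pi.zero_apply]
      positivity
  rw [hS] at hpos
  linarith
end

section
/- For every positive integer n, the quantity π²/6 − n² c_n² + n w_n equals the variance of ln W, where W is the maximum of n i.i.d. Exponential(1) random variables, c_n = -(1/n) ∑_{j=1}^n (-1)^j C(n,j) ln j and w_n = -(1/n) ∑_{j=1}^n (-1)^j C(n,j) (ln j)^2. -/
open Real MeasureTheory Finset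

section

open Filter Topology

lemma gamma_analytic : AnalyticAt ℂ Complex.Gamma 1 := by
  have : DifferentiableOn ℂ Complex.Gamma {s : ℂ | 0 < s.re} := by
    intro s hs
    apply DifferentiableAt.differentiableWithinAt
    apply Complex.differentiableAt_Gamma
    intro m h
    rw [h] at hs
    simp at hs
    linarith [(Nat.cast_nonneg m : (0:ℝ) ≤ m)]
  exact this.analyticAt ((isOpen_lt continuous_const Complex.continuous_re).mem_nhds (by simp))

lemma refl_ev : (fun s : ℂ => (Complex.Gamma (1 + s) * Complex.Gamma (1 - s)) * Complex.sin (π * s))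
    =ᶠ[𝓝 0] fun s => (π : ℂ) * s := by
  filter_upwards [Metric.ball_mem_nhds (0:ℂ) one_pos] with s hs
  by_cases h0 : s = 0
  · simp [h0]
  have hs1 : ‖s‖ < 1 := by simpa using hs
  have hsin : Complex.sin (π * s) ≠ 0 := by
    intro h
    rw [Complex.sin_eq_zero_iff] at h
    obtain ⟨k, hk⟩ := h
    have hpi : (π : ℂ) ≠ 0 := by exact_mod_cast pi_ne_zero
    have hsk : s = k := by
      apply mul_left_cancel₀ hpi
      rw [hk]; ring
    rw [hsk] at hs1 h0
    simp only [Complex.norm_intCast] at hs1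
    have : |k| < 1 := by exact_mod_cast hs1
    have : k = 0 := by rw [abs_lt] at this; lia
    simp [this] at h0
  rw [add_comm 1 s, Complex.Gamma_add_one s h0, mul_assoc s, Complex.Gamma_mul_Gamma_one_sub, mul_assoc, div_mul_cancel₀ _ hsin, mul_comm]

lemma gamma_second : iteratedDeriv 2 Complex.Gamma 1 - (deriv Complex.Gamma 1) ^ 2 = (π:ℂ) ^ 2 / 6 := by
  have hpi : (π : ℂ) ≠ 0 := by exact_mod_cast pi_ne_zero
  have hA : ∀ k, iteratedDeriv k (fun s : ℂ => Complex.Gamma (1 + s)) 0 = iteratedDeriv k Complex.Gamma 1 := by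
    intro k; rw [iteratedDeriv_comp_const_add]; simp
  have hB : ∀ k, iteratedDeriv k (fun s : ℂ => Complex.Gamma (1 - s)) 0 = (-1) ^ k * iteratedDeriv k Complex.Gamma 1 := by
    intro k; rw [iteratedDeriv_comp_const_sub]; simp
  have cA : ∀ n : ℕ, ContDiffAt ℂ n (fun s : ℂ => Complex.Gamma (1 + s)) 0 := by
    intro n
    apply AnalyticAt.contDiffAt
    apply AnalyticAt.fun_comp (by simpa using gamma_analytic)
    fun_prop
  have cB : ∀ n : ℕ, ContDiffAt ℂ n (fun s : ℂ => Complex.Gamma (1 - s)) 0 := by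
    intro n
    apply AnalyticAt.contDiffAt
    apply AnalyticAt.fun_comp (by simpa using gamma_analytic)
    fun_prop
  have cS : ∀ n : ℕ, ContDiffAt ℂ n (fun s : ℂ => Complex.sin (π * s)) 0 := by
    intro n
    fun_prop
  have d1 : deriv (fun s : ℂ => Complex.sin (π * s)) = fun s => π * Complex.cos (π * s) := by
    ext s
    have := ((hasDerivAt_id s).const_mul (π:ℂ)).csin
    simpa [mul_comm] using this.deriv
  have d2 : deriv (fun s : ℂ => π * Complex.cos (π * s)) = fun s => - π ^ 2 * Complex.sin (π * s) := by
    ext s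
    have := (((hasDerivAt_id s).const_mul (π:ℂ)).ccos).const_mul (π:ℂ)
    rw [show (fun s : ℂ => π * Complex.cos (π * s)) = fun y ↦ (π:ℂ) * Complex.cos (π * id y) from rfl, this.deriv]
    simp; ring
  have d3 : deriv (fun s : ℂ => - π ^ 2 * Complex.sin (π * s)) 0 = - π ^ 3 := by
    rw [deriv_const_mul_field, d1]; simp; ring
  have s1 : iteratedDeriv 1 (fun s : ℂ => Complex.sin (π * s)) 0 = π := by
    rw [iteratedDeriv_one, d1]; simp
  have s2 : iteratedDeriv 2 (fun s : ℂ => Complex.sin (π * s)) 0 = 0 := by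
    rw [iteratedDeriv_succ', iteratedDeriv_one, d1, d2]; simp
  have s3 : iteratedDeriv 3 (fun s : ℂ => Complex.sin (π * s)) 0 = - π ^ 3 := by
    rw [iteratedDeriv_succ', iteratedDeriv_succ', iteratedDeriv_one, d1, d2, d3]
  have r3 : iteratedDeriv 3 (fun s : ℂ => (π:ℂ) * s) 0 = 0 := by
    rw [iteratedDeriv_succ', iteratedDeriv_succ', iteratedDeriv_one]
    have : deriv (fun s : ℂ => (π:ℂ) * s) = fun _ => (π:ℂ) := by
      ext s; simp
    rw [this]; simp
  have key := refl_ev.iteratedDeriv_eq 3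
  rw [r3, iteratedDeriv_fun_mul ((cA 3).mul (cB 3)) (cS 3)] at key
  simp only [Finset.sum_range_succ, Finset.sum_range_zero, s1, s2, s3, iteratedDeriv_zero] at key
  rw [iteratedDeriv_fun_mul (cA 2) (cB 2)] at key
  simp only [Finset.sum_range_succ, Finset.sum_range_zero, hA, hB] at key
  simp [iteratedDeriv_one, Nat.choose] at key
  have : (π:ℂ) * (iteratedDeriv 2 Complex.Gamma 1 - (deriv Complex.Gamma 1) ^ 2 - (π:ℂ) ^ 2 / 6) = 0 := by
    linear_combination key / 6
  have := (mul_eq_zero.mp this).resolve_left hpi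
  linear_combination this

lemma expB : (fun t : ℝ => ((Real.exp (-t) : ℝ) : ℂ)) =O[atTop] (fun t : ℝ => t ^ (-(4:ℝ))) := by
  rw [← Asymptotics.isBigO_norm_left]
  simp_rw [Complex.norm_real, Asymptotics.isBigO_norm_left]
  simpa only [neg_one_mul] using (isLittleO_exp_neg_mul_rpow_atTop zero_lt_one _).isBigO

lemma expB0 : (fun t : ℝ => ((Real.exp (-t) : ℝ) : ℂ)) =O[𝓝[>] 0] (fun t : ℝ => t ^ (-(0:ℝ))) := by
  simp_rw [neg_zero, rpow_zero]
  refine Asymptotics.isBigO_const_of_tendsto (?_ : Tendsto _ _ (𝓝 (1 : ℂ))) one_ne_zero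
  rw [(by simp : (1 : ℂ) = Real.exp (-0))]
  exact (Complex.continuous_ofReal.comp (Real.continuous_exp.comp continuous_neg)).continuousWithinAt

lemma mel1 {s : ℂ} (h0 : 0 < s.re) (h4 : s.re < 4) :
    MellinConvergent (fun t : ℝ => Real.log t • ((Real.exp (-t) : ℝ) : ℂ)) s ∧
      HasDerivAt (mellin (fun t : ℝ => ((Real.exp (-t) : ℝ) : ℂ)))
       (mellin (fun t : ℝ => Real.log t • ((Real.exp (-t) : ℝ) : ℂ)) s) s := by
  apply mellin_hasDerivAt_of_isBigO_rpow (E := ℂ) _ expB h4 expB0 h0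
  refine (Continuous.continuousOn ?_).locallyIntegrableOn measurableSet_Ioi
  exact Complex.continuous_ofReal.comp (Real.continuous_exp.comp continuous_neg)

lemma mel2 :
    MellinConvergent (fun t : ℝ => Real.log t • Real.log t • ((Real.exp (-t) : ℝ) : ℂ)) 1 ∧
      HasDerivAt (mellin (fun t : ℝ => Real.log t • ((Real.exp (-t) : ℝ) : ℂ)))
       (mellin (fun t : ℝ => Real.log t • Real.log t • ((Real.exp (-t) : ℝ) : ℂ)) 1) 1 := by
  apply mellin_hasDerivAt_of_isBigO_rpow (E := ℂ) _ (isBigO_rpow_top_log_smul (b := 3) (by norm_num) expB)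
    (by norm_num) (isBigO_rpow_zero_log_smul (b := 1/2) (by norm_num) expB0) (by norm_num)
  refine (ContinuousOn.smul (Real.continuousOn_log.mono (by simp)) (Continuous.continuousOn ?_)).locallyIntegrableOn measurableSet_Ioi
  exact Complex.continuous_ofReal.comp (Real.continuous_exp.comp continuous_neg)

lemma gamma_mel_ev : ∀ s : ℂ, 0 < s.re → Complex.Gamma =ᶠ[𝓝 s] mellin (fun t : ℝ => ((Real.exp (-t) : ℝ) : ℂ)) := by
  intro s hs
  filter_upwards [(isOpen_lt continuous_const Complex.continuous_re).mem_nhds hs] with z hz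
  rw [Complex.Gamma_eq_integral hz, Complex.GammaIntegral_eq_mellin]

lemma d_gamma {s : ℂ} (h0 : 0 < s.re) (h4 : s.re < 4) :
    deriv Complex.Gamma s = mellin (fun t : ℝ => Real.log t • ((Real.exp (-t) : ℝ) : ℂ)) s := by
  rw [(gamma_mel_ev s h0).deriv_eq, (mel1 h0 h4).2.deriv]

lemma d2_gamma : iteratedDeriv 2 Complex.Gamma 1 =
    mellin (fun t : ℝ => Real.log t • Real.log t • ((Real.exp (-t) : ℝ) : ℂ)) 1 := by
  rw [iteratedDeriv_succ', iteratedDeriv_one]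
  have : deriv Complex.Gamma =ᶠ[𝓝 1] mellin (fun t : ℝ => Real.log t • ((Real.exp (-t) : ℝ) : ℂ)) := by
    filter_upwards [(isOpen_lt continuous_const Complex.continuous_re).mem_nhds (show (0:ℝ) < (1:ℂ).re by simp),
      (isOpen_lt Complex.continuous_re continuous_const).mem_nhds (show (1:ℂ).re < (4:ℝ) by norm_num)] with z h1 h2
    exact d_gamma h1 h2
  rw [this.deriv_eq, mel2.2.deriv]

lemma int0 : IntegrableOn (fun x : ℝ => Real.exp (-x)) (Set.Ioi 0) := integrableOn_exp_neg_Ioi 0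

lemma int1 : IntegrableOn (fun x : ℝ => Real.log x * Real.exp (-x)) (Set.Ioi 0) := by
  have := (mel1 (s := 1) (by norm_num) (by norm_num)).1
  simp only [MellinConvergent, sub_self, Complex.cpow_zero, one_smul] at this
  have := this.re
  simpa [IntegrableOn, ← Complex.ofReal_exp, ← Complex.ofReal_neg, -Complex.ofReal_neg,-Complex.ofReal_exp] using this

lemma int2 : IntegrableOn (fun x : ℝ => Real.log x ^ 2 * Real.exp (-x)) (Set.Ioi 0) := by
  have := mel2.1
  simp only [MellinConvergent, sub_self, Complex.cpow_zero, one_smul] at this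
  have := this.re
  simpa [IntegrableOn, ← Complex.ofReal_exp, ← Complex.ofReal_neg, -Complex.ofReal_neg,-Complex.ofReal_exp, pow_two, mul_assoc] using this

lemma moments : (∫ x in Set.Ioi (0:ℝ), Real.log x ^ 2 * Real.exp (-x))
    - (∫ x in Set.Ioi (0:ℝ), Real.log x * Real.exp (-x)) ^ 2 = π ^ 2 / 6 := by
  have h := gamma_second
  rw [d2_gamma, d_gamma (by norm_num) (by norm_num)] at h
  simp only [mellin, sub_self, Complex.cpow_zero, one_smul] at h
  have e1 : (∫ t in Set.Ioi (0:ℝ), Real.log t • ((Real.exp (-t) : ℝ) : ℂ))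
      = ((∫ x in Set.Ioi (0:ℝ), Real.log x * Real.exp (-x) : ℝ) : ℂ) := by
    rw [← integral_complex_ofReal]; congr 1; ext t; simp
  have e2 : (∫ t in Set.Ioi (0:ℝ), Real.log t • Real.log t • ((Real.exp (-t) : ℝ) : ℂ))
      = ((∫ x in Set.Ioi (0:ℝ), Real.log x ^ 2 * Real.exp (-x) : ℝ) : ℂ) := by
    rw [← integral_complex_ofReal]; congr 1; ext t; simp; ring
  rw [e1, e2] at h
  exact_mod_cast h

lemma scal (j : ℝ) (hj : 0 < j) (k : ℕ)
    (hI : IntegrableOn (fun x : ℝ => (Real.log x - Real.log j) ^ k * Real.exp (-x)) (Set.Ioi 0)) :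
    IntegrableOn (fun x : ℝ => Real.log x ^ k * (j * Real.exp (-(j * x)))) (Set.Ioi 0) ∧
    ∫ x in Set.Ioi (0:ℝ), Real.log x ^ k * (j * Real.exp (-(j * x)))
      = ∫ x in Set.Ioi (0:ℝ), (Real.log x - Real.log j) ^ k * Real.exp (-x) := by
  have e : Set.EqOn (fun x : ℝ => j * ((Real.log (j * x) - Real.log j) ^ k * Real.exp (-(j * x))))
      (fun x : ℝ => Real.log x ^ k * (j * Real.exp (-(j * x)))) (Set.Ioi 0) := by
    intro x hx
    have hx : 0 < x := hx
    simp only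
    rw [Real.log_mul hj.ne' hx.ne']
    ring
  constructor
  · have := (integrableOn_Ioi_comp_mul_left_iff (fun x : ℝ => (Real.log x - Real.log j) ^ k * Real.exp (-x)) 0 hj).2 (by simpa using hI)
    exact IntegrableOn.congr_fun (this.const_mul j) e measurableSet_Ioi
  · rw [← setIntegral_congr_fun measurableSet_Ioi e, integral_const_mul,
      integral_comp_mul_left_Ioi (fun x : ℝ => (Real.log x - Real.log j) ^ k * Real.exp (-x)) 0 hj]
    simp
    field_simp

lemma scal1 (j : ℝ) (hj : 0 < j) :
    IntegrableOn (fun x : ℝ => Real.log x * (j * Real.exp (-(j * x)))) (Set.Ioi 0) ∧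
    ∫ x in Set.Ioi (0:ℝ), Real.log x * (j * Real.exp (-(j * x)))
      = (∫ x in Set.Ioi (0:ℝ), Real.log x * Real.exp (-x)) - Real.log j := by
  have e : (fun x : ℝ => (Real.log x - Real.log j) ^ 1 * Real.exp (-x)) =
    fun x => Real.log x * Real.exp (-x) - Real.log j * Real.exp (-x) := by ext; ring
  have := scal j hj 1 (by rw [e]; exact int1.sub (int0.const_mul _))
  rw [e, integral_sub int1 (int0.const_mul _), integral_const_mul, integral_exp_neg_Ioi_zero] at this
  simpa using this

lemma scal2 (j : ℝ) (hj : 0 < j) :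
    IntegrableOn (fun x : ℝ => Real.log x ^ 2 * (j * Real.exp (-(j * x)))) (Set.Ioi 0) ∧
    ∫ x in Set.Ioi (0:ℝ), Real.log x ^ 2 * (j * Real.exp (-(j * x)))
      = (∫ x in Set.Ioi (0:ℝ), Real.log x ^ 2 * Real.exp (-x))
       - 2 * Real.log j * (∫ x in Set.Ioi (0:ℝ), Real.log x * Real.exp (-x)) + Real.log j ^ 2 := by
  have e : (fun x : ℝ => (Real.log x - Real.log j) ^ 2 * Real.exp (-x)) =
    fun x => (Real.log x ^ 2 * Real.exp (-x) - (2 * Real.log j) * (Real.log x * Real.exp (-x))) + Real.log j ^ 2 * Real.exp (-x) := by ext; ring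
  have i1 : IntegrableOn (fun x : ℝ => Real.log x ^ 2 * Real.exp (-x) - (2 * Real.log j) * (Real.log x * Real.exp (-x))) (Set.Ioi 0) :=
    int2.sub (int1.const_mul (2 * Real.log j))
  have := scal j hj 2 (by rw [e]; exact i1.add (int0.const_mul _))
  rw [e, integral_add i1 (int0.const_mul _), integral_sub int2 (int1.const_mul _), integral_const_mul, integral_const_mul, integral_exp_neg_Ioi_zero] at this
  simpa using this

lemma dens (n : ℕ) (hn : 1 ≤ n) (x : ℝ) :
    (n : ℝ) * Real.exp (-x) * (1 - Real.exp (-x)) ^ (n - 1) =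
    ∑ j ∈ Finset.Icc 1 n, -((-1 : ℝ) ^ j * (n.choose j : ℝ)) * (j * Real.exp (-(j * x))) := by
  obtain ⟨m, rfl⟩ : ∃ m, n = m + 1 := ⟨n - 1, by lia⟩
  have : Finset.Icc 1 (m+1) = Finset.Ico (0 + 1) (m + 1 + 1) := by ext; simp
  rw [this, ← Finset.sum_Ico_add', ← Finset.range_eq_Ico, Nat.add_sub_cancel, sub_eq_neg_add, add_pow, Finset.mul_sum]
  refine Finset.sum_congr rfl fun k _ => ?_
  have h1 : ((m + 1 : ℕ) : ℝ) * (m.choose k) = ((m+1).choose (k+1)) * ((k + 1 : ℕ) : ℝ) := by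
    exact_mod_cast Nat.add_one_mul_choose_eq m k
  have h2 : Real.exp (-(((k + 1 : ℕ) : ℝ) * x)) = Real.exp (-x) ^ (k + 1) := by
    rw [← Real.exp_nat_mul]; ring_nf
  rw [h2, neg_pow]
  simp only [one_pow]
  linear_combination (Real.exp (-x)) ^ (k+1) * (-1) ^ k * h1

lemma wsum (n : ℕ) (hn : 1 ≤ n) :
    ∑ j ∈ Finset.Icc 1 n, -((-1 : ℝ) ^ j * (n.choose j : ℝ)) = 1 := by
  have h := Int.alternating_sum_range_choose_of_ne (n := n) (by lia)
  have h' : ∑ j ∈ Finset.range (n+1), ((-1 : ℝ) ^ j * (n.choose j : ℝ)) = 0 := by exact_mod_cast h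
  rw [Finset.range_eq_Ico, Finset.sum_eq_sum_Ico_succ_bot (by lia)] at h'
  have : Finset.Icc 1 n = Finset.Ico (0 + 1) (n + 1) := by ext; simp
  rw [this, Finset.sum_neg_distrib]
  simp at h' ⊢
  linarith

end

theorem stmt10 (n : ℕ) (hn : 1 ≤ n)
    (c w : ℝ)
    (hc : c = -(1 / (n : ℝ)) * ∑ j ∈ Finset.Icc 1 n, (-1 : ℝ) ^ j * (n.choose j : ℝ) * Real.log j)
    (hw : w = -(1 / (n : ℝ)) * ∑ j ∈ Finset.Icc 1 n, (-1 : ℝ) ^ j * (n.choose j : ℝ) * (Real.log j) ^ 2) :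
    Real.pi ^ 2 / 6 - (n : ℝ) ^ 2 * c ^ 2 + (n : ℝ) * w
      = (∫ x in Set.Ioi (0:ℝ), (Real.log x) ^ 2 * ((n : ℝ) * Real.exp (-x) * (1 - Real.exp (-x)) ^ (n - 1)))
        - (∫ x in Set.Ioi (0:ℝ), Real.log x * ((n : ℝ) * Real.exp (-x) * (1 - Real.exp (-x)) ^ (n - 1))) ^ 2 := by
  have hn0 : (n : ℝ) ≠ 0 := by positivity
  have hpos : ∀ j ∈ Finset.Icc 1 n, (0:ℝ) < j := by
    intro j hj
    have := (Finset.mem_Icc.mp hj).1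
    positivity
  have hc' : (n:ℝ) * c = ∑ j ∈ Finset.Icc 1 n, -((-1 : ℝ) ^ j * (n.choose j : ℝ)) * Real.log j := by
    rw [hc]; simp only [neg_mul, Finset.sum_neg_distrib]; field_simp
  have hw' : (n:ℝ) * w = ∑ j ∈ Finset.Icc 1 n, -((-1 : ℝ) ^ j * (n.choose j : ℝ)) * Real.log j ^ 2 := by
    rw [hw]; simp only [neg_mul, Finset.sum_neg_distrib]; field_simp
  have hM := moments
  set M1 := ∫ x in Set.Ioi (0:ℝ), Real.log x * Real.exp (-x) with hM1
  set M2 := ∫ x in Set.Ioi (0:ℝ), Real.log x ^ 2 * Real.exp (-x) with hM2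
  have I1 : ∫ x in Set.Ioi (0:ℝ), Real.log x * ((n : ℝ) * Real.exp (-x) * (1 - Real.exp (-x)) ^ (n - 1)) = M1 - n * c := by
    simp_rw [dens n hn, Finset.mul_sum, mul_left_comm (Real.log _) (-_)]
    rw [integral_finsetSum _ (fun (j : ℕ) hj => (scal1 (j : ℝ) (hpos j hj)).1.const_mul _)]
    simp_rw [integral_const_mul]
    rw [Finset.sum_congr rfl (fun (j : ℕ) hj => by rw [(scal1 (j : ℝ) (hpos j hj)).2]), ← hM1]
    simp_rw [mul_sub, Finset.sum_sub_distrib, ← Finset.sum_mul, wsum n hn]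
    rw [hc', one_mul]
  have I2 : ∫ x in Set.Ioi (0:ℝ), Real.log x ^ 2 * ((n : ℝ) * Real.exp (-x) * (1 - Real.exp (-x)) ^ (n - 1)) = M2 - 2 * M1 * (n * c) + n * w := by
    simp_rw [dens n hn, Finset.mul_sum, mul_left_comm (Real.log _ ^ 2) (-_)]
    rw [integral_finsetSum _ (fun (j : ℕ) hj => (scal2 (j : ℝ) (hpos j hj)).1.const_mul _)]
    simp_rw [integral_const_mul]
    rw [Finset.sum_congr rfl (fun (j : ℕ) hj => by rw [(scal2 (j : ℝ) (hpos j hj)).2]), ← hM1, ← hM2]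
    simp_rw [mul_add, mul_sub, Finset.sum_add_distrib, Finset.sum_sub_distrib, ← Finset.sum_mul, wsum n hn]
    rw [hw', hc', one_mul, Finset.mul_sum]
    congr 2
    exact Finset.sum_congr rfl fun j _ => by ring
  rw [I1, I2]
  linear_combination -hM
end
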